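/- Let K be a number field and S a set of prime ideals of K possessing a natural density δ(S). Then Σ_{2 ≤ N(a) ≤ X} Q_S(a) ∼ c_K·δ(S)·X as X → ∞; that is, the sum divided by X tends to c_K·δ(S). -/

import Mathlib

open NumberField Ideal Filter

noncomputable section

namespace AlladiGen

variable (K : Type*) [Field K] [NumberField K]

open Classical in
/-- The generalized Möbius function on integral ideals. -/
def muK (a : Ideal (𝓞 K)) : ℤ :=
  if Squarefree a then (-1) ^ (Nat.card {p : Ideal (𝓞 K) // p.IsPrime ∧ a ≤ p}) else 0

/-- `p` is a prime ideal of minimal norm among those containing `a`. -/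
def MinimalPrime (a p : Ideal (𝓞 K)) : Prop :=
  p.IsPrime ∧ a ≤ p ∧ ∀ q : Ideal (𝓞 K), q.IsPrime → a ≤ q → absNorm p ≤ absNorm q

/-- `a ∈ D(K,S)`: `a` is distinguishable with minimal prime in `S`. -/
def InD (S : Set (Ideal (𝓞 K))) (a : Ideal (𝓞 K)) : Prop :=
  ∃ p : Ideal (𝓞 K), MinimalPrime K a p ∧ p ∈ S ∧ ∀ q : Ideal (𝓞 K), MinimalPrime K a q → q = p

/-- `π_S(K; X)`: number of prime ideals in `S` of norm at most `X`. -/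
def primeCount (S : Set (Ideal (𝓞 K))) (X : ℝ) : ℕ :=
  Nat.card {p : Ideal (𝓞 K) // p.IsPrime ∧ p ∈ S ∧ (absNorm p : ℝ) ≤ X}

/-- `S` has natural density `δ` within the prime ideals of `K`. -/
def HasPrimeDensity (S : Set (Ideal (𝓞 K))) (δ : ℝ) : Prop :=
  Tendsto (fun X : ℝ => (primeCount K S X : ℝ) / (primeCount K Set.univ X : ℝ))
    atTop (nhds δ)

/-- `M(a)`: the maximal norm of a prime ideal containing `a`. -/
def maxNorm (a : Ideal (𝓞 K)) : ℕ :=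
  sSup (absNorm '' {p : Ideal (𝓞 K) | p.IsPrime ∧ a ≤ p})

/-- `Q_S(a)`: number of primes in `S` containing `a` of maximal norm. -/
def QS (S : Set (Ideal (𝓞 K))) (a : Ideal (𝓞 K)) : ℕ :=
  Nat.card {p : Ideal (𝓞 K) // p.IsPrime ∧ a ≤ p ∧ p ∈ S ∧ absNorm p = maxNorm K a}

/-- `c_K`: residue of the Dedekind zeta function at 1, via the analytic class number formula. -/
def cK : ℝ :=
  (2 ^ (InfinitePlace.nrRealPlaces K) * (2 * Real.pi) ^ (InfinitePlace.nrComplexPlaces K) *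
    NumberField.Units.regulator K * (NumberField.classNumber K)) /
  ((NumberField.Units.torsionOrder K : ℝ) * Real.sqrt |(NumberField.discr K : ℝ)|)

/-- `Ψ(X,Y)`: number of `Y`-smooth nonzero integral ideals of norm at most `X`. -/
def Psi (X Y : ℝ) : ℕ :=
  Nat.card {a : Ideal (𝓞 K) // a ≠ ⊥ ∧ (absNorm a : ℝ) ≤ X ∧
    ∀ p : Ideal (𝓞 K), p.IsPrime → a ≤ p → (absNorm p : ℝ) ≤ Y}

/-- `[X]_K`: number of nonzero integral ideals of norm at most `X`. -/
def idealCount (X : ℝ) : ℕ := Nat.card {a : Ideal (𝓞 K) // a ≠ ⊥ ∧ (absNorm a : ℝ) ≤ X}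

/-- The logarithmic integral `Li(X) = ∫_2^X dt / log t`. -/
def Li (X : ℝ) : ℝ := ∫ t in (2:ℝ)..X, 1 / Real.log t


/-! ### Part 1: finite sets of ideals and prime ideals -/

/-- Nonzero ideals of norm at most `n`. -/
def ids (n : ℕ) : Finset (Ideal (𝓞 K)) :=
  ((Ideal.finite_setOfPred_absNorm_le (S := 𝓞 K) n).subset
    (t := {I | 1 ≤ absNorm I ∧ absNorm I ≤ n}) (fun _ h => h.2)).toFinset

theorem mem_ids {n : ℕ} {a : Ideal (𝓞 K)} : a ∈ ids K n ↔ 1 ≤ absNorm a ∧ absNorm a ≤ n := by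
  simp [ids]

open Classical in
/-- Nonzero prime ideals of norm at most `n`. -/
def prs (n : ℕ) : Finset (Ideal (𝓞 K)) := (ids K n).filter (fun p => p.IsPrime)

theorem mem_prs {n : ℕ} {a : Ideal (𝓞 K)} :
    a ∈ prs K n ↔ (1 ≤ absNorm a ∧ absNorm a ≤ n) ∧ a.IsPrime := by
  simp [prs, mem_ids]

theorem norm_pos_of_ne {p : Ideal (𝓞 K)} (hp : p ≠ ⊥) : 1 ≤ absNorm p :=
  Nat.one_le_iff_ne_zero.mpr (by rwa [Ne, absNorm_eq_zero_iff])

theorem ne_bot_of_norm {p : Ideal (𝓞 K)} (hp : 1 ≤ absNorm p) : p ≠ ⊥ := by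
  rintro rfl
  simp at hp

theorem two_le_norm {p : Ideal (𝓞 K)} (h0 : 1 ≤ absNorm p) (hp : p.IsPrime) : 2 ≤ absNorm p := by
  have : absNorm p ≠ 1 := by
    rw [Ne, absNorm_eq_one_iff]; exact hp.ne_top
  omega

theorem minFac_mem {p : Ideal (𝓞 K)} (h0 : 1 ≤ absNorm p) (hp : p.IsPrime) :
    (((absNorm p).minFac : ℕ) : 𝓞 K) ∈ p := by
  obtain ⟨r, hr, hrp⟩ : ∃ r : ℕ, r.Prime ∧ (r : 𝓞 K) ∈ p := by
    have key : ∀ n : ℕ, n ≠ 0 → (n : 𝓞 K) ∈ p → ∃ r : ℕ, r.Prime ∧ (r : 𝓞 K) ∈ p := by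
      intro n
      induction n using Nat.recOnMul with
      | zero => intro h; exact absurd rfl h
      | one => intro _ h; exact absurd ((Ideal.eq_top_iff_one _).2 (by simpa using h)) hp.ne_top
      | prime q hq => intro _ h; exact ⟨q, hq, h⟩
      | mul a b iha ihb =>
        intro h hm
        rw [Nat.cast_mul] at hm
        rcases hp.mem_or_mem hm with h1 | h1
        · exact iha (by rintro rfl; simp at h) h1
        · exact ihb (by rintro rfl; simp at h) h1
    exact key (absNorm p) (by omega) (absNorm_mem p)
  have hdvd : absNorm p ∣ r ^ Module.finrank ℤ (𝓞 K) := by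
    rw [← absNorm_span_natCast]
    exact absNorm_dvd_absNorm_of_le ((span_singleton_le_iff_mem p).2 hrp)
  have h2 := two_le_norm K h0 hp
  have hmp : (absNorm p).minFac.Prime := Nat.minFac_prime (by omega)
  have : (absNorm p).minFac ∣ r :=
    hmp.dvd_of_dvd_pow ((Nat.minFac_dvd _).trans hdvd)
  rwa [(Nat.prime_dvd_prime_iff_eq hmp hr).1 this]

theorem card_over (T : Finset (Ideal (𝓞 K))) (r : ℕ)
    (hT : ∀ p ∈ T, 1 ≤ absNorm p ∧ p.IsPrime ∧ (absNorm p).minFac = r) :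
    T.card ≤ Module.finrank ℤ (𝓞 K) := by
  rcases T.eq_empty_or_nonempty with rfl | ⟨p0, hp0⟩
  · simp
  have hr : r.Prime := by
    obtain ⟨h1, h2, rfl⟩ := hT p0 hp0
    have := two_le_norm K h1 h2
    exact Nat.minFac_prime (by omega)
  have h1 : ∏ p ∈ T, p ∣ span {(r : 𝓞 K)} := by
    apply Finset.prod_primes_dvd
    · intro p hp
      exact prime_of_isPrime (ne_bot_of_norm K (hT p hp).1) (hT p hp).2.1
    · intro p hp
      rw [dvd_iff_le, span_singleton_le_iff_mem]
      have := minFac_mem K (hT p hp).1 (hT p hp).2.1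
      rwa [(hT p hp).2.2] at this
  have h2 : ∏ p ∈ T, absNorm p ∣ r ^ Module.finrank ℤ (𝓞 K) := by
    rw [← absNorm_span_natCast, ← map_prod]
    exact map_dvd absNorm h1
  have h3 : r ^ T.card ≤ ∏ p ∈ T, absNorm p := by
    apply Finset.pow_card_le_prod
    intro p hp
    rw [← (hT p hp).2.2]
    exact Nat.minFac_le (hT p hp).1
  have h4 := h3.trans (Nat.le_of_dvd (pow_pos hr.pos _) h2)
  exact (Nat.pow_le_pow_iff_right hr.one_lt).1 h4

theorem card_prs_le (n : ℕ) :
    (prs K n).card ≤ Module.finrank ℤ (𝓞 K) * n.primeCounting := by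
  classical
  refine (Finset.card_le_mul_card_image (f := fun p => (absNorm p).minFac) _
    (Module.finrank ℤ (𝓞 K)) ?_).trans ?_
  · intro r _
    apply card_over K _ r
    intro p hp
    rw [Finset.mem_filter, mem_prs] at hp
    exact ⟨hp.1.1.1, hp.1.2, hp.2⟩
  · gcongr
    rw [← Nat.primesLE_card_eq_primeCounting]
    apply Finset.card_le_card
    intro r hr
    obtain ⟨p, hp, rfl⟩ := Finset.mem_image.1 hr
    rw [mem_prs] at hp
    have := two_le_norm K hp.1.1 hp.2
    rw [Nat.mem_primesLE]
    exact ⟨(Nat.minFac_le (by omega)).trans hp.1.2, Nat.minFac_prime (by omega)⟩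

theorem pi_bound : ∃ C : ℝ, 0 < C ∧ ∀ n : ℕ, 2 ≤ n →
    ((prs K n).card : ℝ) + 1 ≤ C * n / Real.log n := by
  set d : ℝ := (Module.finrank ℤ (𝓞 K) : ℝ) with hd
  have hd0 : 0 ≤ d := by positivity
  have hlog4 : 0 < Real.log 4 := Real.log_pos (by norm_num)
  refine ⟨d * (Real.log 4 * 2 + 2) + 1, by positivity, fun n hn => ?_⟩
  have hn' : (2:ℝ) ≤ n := by exact_mod_cast hn
  have hlog : 0 < Real.log n := Real.log_pos (by linarith)
  have h1 : ((prs K n).card : ℝ) ≤ d * n.primeCounting := by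
    rw [hd]; exact_mod_cast card_prs_le K n
  have h2 := Chebyshev.pi_le_log4_mul_div (x := n) (by linarith)
  rw [Nat.floor_natCast, Real.log_sqrt (by linarith)] at h2
  have hsq : Real.sqrt n * Real.sqrt n = n := Real.mul_self_sqrt (by linarith)
  have hsp : 0 < Real.sqrt n := Real.sqrt_pos.2 (by linarith)
  have h3 : Real.log n ≤ 2 * Real.sqrt n := by
    have := Real.log_le_sub_one_of_pos hsp
    rw [Real.log_sqrt (by linarith)] at this
    linarith
  have h4 : Real.sqrt n ≤ 2 * n / Real.log n := by
    rw [le_div_iff₀ hlog]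
    nlinarith
  have h5 : 1 ≤ n / Real.log n := by
    rw [le_div_iff₀ hlog]
    have := Real.log_le_sub_one_of_pos (x := n) (by linarith)
    linarith
  have h6 : (n.primeCounting : ℝ) ≤ (Real.log 4 * 2 + 2) * (n / Real.log n) := by
    refine h2.trans ?_
    have : Real.log 4 * n / (Real.log n / 2) = Real.log 4 * 2 * (n / Real.log n) := by
      field_simp
    rw [this]
    have : 2 * n / Real.log n = 2 * (n / Real.log n) := by ring
    linarith
  calc ((prs K n).card : ℝ) + 1 ≤ d * ((Real.log 4 * 2 + 2) * (n / Real.log n)) + n / Real.log n := by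
        have := mul_le_mul_of_nonneg_left h6 hd0
        linarith
    _ = _ := by ring

theorem card_same_norm (T : Finset (Ideal (𝓞 K))) (n : ℕ)
    (hT : ∀ p ∈ T, 1 ≤ absNorm p ∧ p.IsPrime ∧ absNorm p = n) :
    T.card ≤ Module.finrank ℤ (𝓞 K) := by
  apply card_over K T n.minFac
  intro p hp
  obtain ⟨h1, h2, h3⟩ := hT p hp
  exact ⟨h1, h2, by rw [h3]⟩

theorem ids_tendsto :
    Tendsto (fun n : ℕ => ((ids K n).card : ℝ) / n) atTop (nhds (cK K)) := by
  refine ((NumberField.Ideal.tendsto_norm_le_div_atTop₀ K).comp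
    tendsto_natCast_atTop_atTop).congr fun n ↦ ?_
  simp only [Function.comp_apply, Nat.cast_le]
  congr 2
  rw [← Fintype.card_coe, ← Nat.card_eq_fintype_card]
  refine Nat.card_congr ⟨fun I => ⟨I.1.1, ?_⟩, fun I => ⟨⟨I.1, ?_⟩, ?_⟩, fun I => rfl, fun I => rfl⟩
  · rw [mem_ids]
    exact ⟨norm_pos_of_ne K (nonZeroDivisors.coe_ne_zero I.1), I.2⟩
  · exact mem_nonZeroDivisors_of_ne_zero (ne_bot_of_norm K ((mem_ids K).1 I.2).1)
  · exact ((mem_ids K).1 I.2).2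

theorem ids_bound : ∃ C : ℝ, 0 < C ∧ ∀ n : ℕ, ((ids K n).card : ℝ) ≤ C * n := by
  obtain ⟨C, hC⟩ := (ids_tendsto K).bddAbove_range
  refine ⟨max C 1, by positivity, fun n => ?_⟩
  rcases Nat.eq_zero_or_pos n with rfl | hn
  · have : ids K 0 = ∅ := by
      ext a; rw [mem_ids]; simp; omega
    simp [this]
  · have := hC ⟨n, rfl⟩
    have hn' : (0:ℝ) < n := by exact_mod_cast hn
    simp only [] at this
    rw [div_le_iff₀ hn'] at this
    exact this.trans (by gcongr; exact le_max_left _ _)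

/-- Generic partial summation bound. -/
theorem sum_div_le (f : ℕ → ℝ) (C : ℝ) (hf : ∀ n, ∑ k ∈ Finset.range n, f (k + 1) ≤ C * n) (n : ℕ) :
    ∑ k ∈ Finset.range n, f (k + 1) / ((k + 1 : ℕ) : ℝ) ≤ C * (harmonic n : ℝ) := by
  have key : ∀ n : ℕ, (C * n - ∑ k ∈ Finset.range n, f (k + 1)) / n ≤
      C * (harmonic n : ℝ) - ∑ k ∈ Finset.range n, f (k + 1) / ((k + 1 : ℕ) : ℝ) := by
    intro n
    induction n with
    | zero => simp
    | succ n ih =>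
      rw [Finset.sum_range_succ, Finset.sum_range_succ, harmonic_succ]
      push_cast at ih ⊢
      have hpos : (0:ℝ) < (n:ℝ) + 1 := by positivity
      have h1 : (C * n - ∑ k ∈ Finset.range n, f (k + 1)) / (n + 1) ≤
          (C * n - ∑ k ∈ Finset.range n, f (k + 1)) / n := by
        rcases Nat.eq_zero_or_pos n with rfl | hn
        · simp
        · have hn' : (0:ℝ) < n := by exact_mod_cast hn
          have := hf n
          apply div_le_div_of_nonneg_left _ hn' (by linarith)
          linarith
      have h2 : (C * (n + 1) - (∑ k ∈ Finset.range n, f (k + 1) + f (n + 1))) / ((n:ℝ) + 1) =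
          (C * n - ∑ k ∈ Finset.range n, f (k + 1)) / (n + 1) + C * ((n:ℝ) + 1)⁻¹
            - f (n + 1) / (n + 1) := by
        field_simp; ring
      rw [h2]
      linarith
  have h := key n
  have h0 : 0 ≤ (C * n - ∑ k ∈ Finset.range n, f (k + 1)) / n := by
    have := hf n
    exact div_nonneg (by linarith) (by positivity)
  linarith

theorem sum_ids_fiber (g : Ideal (𝓞 K) → ℝ) (n : ℕ) :
    ∑ b ∈ ids K n, g b = ∑ k ∈ Finset.range n, ∑ b ∈ ids K n with absNorm b = k + 1, g b := by
  rw [← Finset.sum_fiberwise_of_maps_to (s := ids K n) (t := (Finset.range n).image (· + 1))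
    (g := fun b => absNorm b)]
  · rw [Finset.sum_image (by intro a _ b _ h; simpa using h)]
  · intro b hb
    rw [mem_ids] at hb
    simp only [Finset.mem_image, Finset.mem_range]
    exact ⟨absNorm b - 1, by omega, by omega⟩

theorem fiber_eq (n k : ℕ) (h : k < n) :
    (ids K n).filter (fun b => absNorm b = k + 1) =
      (ids K (k + 1)).filter (fun b => absNorm b = k + 1) := by
  ext b
  simp only [Finset.mem_filter, mem_ids]
  omega

theorem sum_ids_div_le (h : Ideal (𝓞 K) → ℝ) (C : ℝ) (hC : 0 ≤ C)
    (hh : ∀ n, ∑ b ∈ ids K n, h b ≤ C * n) (n : ℕ) :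
    ∑ b ∈ ids K n, h b / (absNorm b : ℝ) ≤ C * (1 + Real.log n) := by
  set f : ℕ → ℝ := fun k => ∑ b ∈ ids K k with absNorm b = k, h b with hf
  have e1 : ∀ n, ∑ b ∈ ids K n, h b = ∑ k ∈ Finset.range n, f (k + 1) := by
    intro n
    rw [sum_ids_fiber]
    apply Finset.sum_congr rfl
    intro k hk
    rw [fiber_eq K n k (Finset.mem_range.1 hk)]
  have e2 : ∑ b ∈ ids K n, h b / (absNorm b : ℝ) =
      ∑ k ∈ Finset.range n, f (k + 1) / ((k + 1 : ℕ) : ℝ) := by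
    rw [sum_ids_fiber]
    apply Finset.sum_congr rfl
    intro k hk
    rw [fiber_eq K n k (Finset.mem_range.1 hk), hf, Finset.sum_div]
    apply Finset.sum_congr rfl
    intro b hb
    rw [(Finset.mem_filter.1 hb).2]
  rw [e2]
  refine (sum_div_le f C (fun n => by rw [← e1]; exact hh n) n).trans ?_
  exact mul_le_mul_of_nonneg_left (harmonic_le_one_add_log n) hC

theorem sum_inv_bound : ∃ C : ℝ, 0 < C ∧ ∀ n : ℕ,
    ∑ b ∈ ids K n, 1 / (absNorm b : ℝ) ≤ C * (1 + Real.log n) := by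
  obtain ⟨C, hC, h⟩ := ids_bound K
  refine ⟨C, hC, sum_ids_div_le K (fun _ => 1) C hC.le (fun n => ?_)⟩
  simpa using h n

theorem mertens_bound : ∃ C : ℝ, 0 < C ∧ ∀ n : ℕ,
    ∑ p ∈ prs K n, Real.log (absNorm p) / (absNorm p : ℝ) ≤ C * (1 + Real.log n) := by
  classical
  obtain ⟨C, hC, h⟩ := pi_bound K
  refine ⟨C, hC, fun n => ?_⟩
  have := sum_ids_div_le K (fun p => if p.IsPrime then Real.log (absNorm p) else 0) C hC.le ?_ n
  · rw [prs, Finset.sum_filter]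
    refine le_trans (le_of_eq ?_) this
    apply Finset.sum_congr rfl
    intro p _
    split_ifs <;> simp
  · intro n
    rw [← Finset.sum_filter, ← prs]
    rcases lt_or_ge n 2 with hn | hn
    · have : prs K n = ∅ := by
        ext p
        simp only [mem_prs, Finset.notMem_empty, iff_false]
        rintro ⟨⟨h1, h2⟩, h3⟩
        have := two_le_norm K h1 h3
        omega
      rw [this]; simp; positivity
    · have hn' : (2:ℝ) ≤ n := by exact_mod_cast hn
      have hlog : 0 < Real.log n := Real.log_pos (by linarith)
      have h1 := h n hn
      rw [le_div_iff₀ hlog] at h1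
      calc ∑ p ∈ prs K n, Real.log (absNorm p) ≤ ∑ p ∈ prs K n, Real.log n := by
            apply Finset.sum_le_sum
            intro p hp
            rw [mem_prs] at hp
            apply Real.log_le_log
            · exact_mod_cast hp.1.1
            · exact_mod_cast hp.1.2
        _ = (prs K n).card * Real.log n := by simp
        _ ≤ C * n := by nlinarith

theorem card_dvd_le (C : ℝ) (hC : 0 < C) (h : ∀ n : ℕ, ((ids K n).card : ℝ) ≤ C * n)
    (c : Ideal (𝓞 K)) (hc : 1 ≤ absNorm c) (N : ℕ) (T : Finset (Ideal (𝓞 K)))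
    (hT : ∀ a ∈ T, a ∈ ids K N ∧ c ∣ a) :
    (T.card : ℝ) ≤ C * (N / (absNorm c : ℝ)) := by
  classical
  have h1 : T ⊆ (ids K (N / absNorm c)).image (fun b => c * b) := by
    intro a ha
    obtain ⟨h1, b, rfl⟩ := hT a ha
    refine Finset.mem_image.2 ⟨b, ?_, rfl⟩
    rw [mem_ids, map_mul] at h1
    rw [mem_ids, Nat.le_div_iff_mul_le (by omega)]
    refine ⟨Nat.one_le_iff_ne_zero.2 ?_, by rw [mul_comm]; exact h1.2⟩
    intro h0; rw [h0] at h1; simp at h1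
  have h2 : (T.card : ℝ) ≤ (ids K (N / absNorm c)).card := by
    exact_mod_cast (Finset.card_le_card h1).trans Finset.card_image_le
  refine h2.trans ((h _).trans ?_)
  gcongr
  exact Nat.cast_div_le

/-! ### Part 2: maximal norms and smooth ideals -/

theorem norm_le_of_le {a p : Ideal (𝓞 K)} (ha : 1 ≤ absNorm a) (h : a ≤ p) :
    1 ≤ absNorm p ∧ absNorm p ≤ absNorm a := by
  have h1 := absNorm_dvd_absNorm_of_le h
  exact ⟨Nat.pos_of_dvd_of_pos h1 ha, Nat.le_of_dvd ha h1⟩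

theorem maxNorm_bdd {a : Ideal (𝓞 K)} (ha : 1 ≤ absNorm a) :
    BddAbove (absNorm '' {p : Ideal (𝓞 K) | p.IsPrime ∧ a ≤ p}) := by
  refine ⟨absNorm a, ?_⟩
  rintro _ ⟨p, ⟨_, hp⟩, rfl⟩
  exact (norm_le_of_le K ha hp).2

theorem le_maxNorm {a p : Ideal (𝓞 K)} (ha : 1 ≤ absNorm a) (hp : p.IsPrime) (h : a ≤ p) :
    absNorm p ≤ maxNorm K a :=
  le_csSup (maxNorm_bdd K ha) ⟨p, ⟨hp, h⟩, rfl⟩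

theorem maxNorm_le {a : Ideal (𝓞 K)} {Y : ℕ}
    (h : ∀ p : Ideal (𝓞 K), p.IsPrime → a ≤ p → absNorm p ≤ Y) : maxNorm K a ≤ Y := by
  apply csSup_le'
  rintro _ ⟨p, ⟨hp, hp'⟩, rfl⟩
  exact h p hp hp'

theorem exists_maxNorm {a : Ideal (𝓞 K)} (ha : 1 ≤ absNorm a) (h : 0 < maxNorm K a) :
    ∃ p : Ideal (𝓞 K), p.IsPrime ∧ a ≤ p ∧ absNorm p = maxNorm K a := by
  have hne : (absNorm '' {p : Ideal (𝓞 K) | p.IsPrime ∧ a ≤ p}).Nonempty := by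
    by_contra h0
    rw [Set.not_nonempty_iff_eq_empty] at h0
    rw [maxNorm, h0] at h
    simp at h
  obtain ⟨p, ⟨h1, h2⟩, h3⟩ := Nat.sSup_mem hne (maxNorm_bdd K ha)
  exact ⟨p, h1, h2, h3⟩

theorem maxNorm_mul {p b : Ideal (𝓞 K)} (hp : p.IsPrime) (hp0 : 1 ≤ absNorm p)
    (hb : 1 ≤ absNorm b) : maxNorm K (p * b) = max (absNorm p) (maxNorm K b) := by
  have hpb : 1 ≤ absNorm (p * b) := by rw [map_mul]; exact Nat.mul_pos hp0 hb
  apply le_antisymm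
  · apply maxNorm_le
    intro q hq hle
    rcases hq.mul_le.1 hle with h | h
    · have : p = q := (hp.isMaximal (ne_bot_of_norm K hp0)).eq_of_le hq.ne_top h
      rw [this]; exact le_max_left _ _
    · exact (le_maxNorm K hb hq h).trans (le_max_right _ _)
  · apply max_le
    · exact le_maxNorm K hpb hp Ideal.mul_le_left
    · apply maxNorm_le
      intro q hq h
      exact le_maxNorm K hpb hq (Ideal.mul_le_right.trans h)

open Classical in
theorem QS_eq (S : Set (Ideal (𝓞 K))) {N : ℕ} {a : Ideal (𝓞 K)} (ha : a ∈ ids K N) :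
    QS K S a = ((prs K N).filter (fun p => a ≤ p ∧ p ∈ S ∧ absNorm p = maxNorm K a)).card := by
  rw [QS, ← Fintype.card_coe, ← Nat.card_eq_fintype_card]
  apply Nat.card_congr
  apply Equiv.subtypeEquivRight
  intro p
  rw [mem_ids] at ha
  simp only [Finset.mem_filter, mem_prs]
  constructor
  · rintro ⟨h1, h2, h3, h4⟩
    have := norm_le_of_le K ha.1 h2
    exact ⟨⟨⟨this.1, by omega⟩, h1⟩, h2, h3, h4⟩
  · rintro ⟨⟨_, h1⟩, h2, h3, h4⟩
    exact ⟨h1, h2, h3, h4⟩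

theorem QS_le (S : Set (Ideal (𝓞 K))) {N : ℕ} {a : Ideal (𝓞 K)} (ha : a ∈ ids K N) :
    QS K S a ≤ Module.finrank ℤ (𝓞 K) := by
  classical
  rw [QS_eq K S ha]
  apply card_same_norm K _ (maxNorm K a)
  intro p hp
  rw [Finset.mem_filter, mem_prs] at hp
  exact ⟨hp.1.1.1, hp.1.2, hp.2.2.2⟩

open Classical in
theorem log_norm_le {N Y : ℕ} {a : Ideal (𝓞 K)} (ha : a ∈ ids K N) (hY : maxNorm K a ≤ Y) :
    Real.log (absNorm a) ≤ ∑ p ∈ prs K Y, ∑ k ∈ Finset.Icc 1 N,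
      if p ^ k ∣ a then Real.log (absNorm p) else 0 := by
  have ha' := (mem_ids K).1 ha
  have ha0 : a ≠ 0 := ne_bot_of_norm K ha'.1
  set nf := UniqueFactorizationMonoid.normalizedFactors a with hnf
  have hprod : nf.prod = a := by
    rw [hnf, UniqueFactorizationMonoid.prod_normalizedFactors_eq ha0, normalize_eq]
  have hN : absNorm a = ∏ p ∈ nf.toFinset, absNorm p ^ nf.count p := by
    conv_lhs => rw [← hprod, Finset.prod_multiset_count, map_prod]
    simp
  have hmem : ∀ p ∈ nf.toFinset, p ∈ prs K Y ∧ p ^ nf.count p ∣ a := by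
    intro p hp
    rw [Multiset.mem_toFinset] at hp
    have hpp := UniqueFactorizationMonoid.prime_of_normalized_factor p hp
    have hdvd := UniqueFactorizationMonoid.dvd_of_mem_normalizedFactors hp
    have hpr : p.IsPrime := isPrime_of_prime hpp
    have hle := Ideal.dvd_iff_le.1 hdvd
    have h1 := norm_le_of_le K ha'.1 hle
    refine ⟨(mem_prs K).2 ⟨⟨h1.1, (le_maxNorm K ha'.1 hpr hle).trans hY⟩, hpr⟩, ?_⟩
    conv_rhs => rw [← hprod]
    rw [← Multiset.prod_replicate]
    exact Multiset.prod_dvd_prod_of_le (Multiset.le_count_iff_replicate_le.1 le_rfl)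
  rw [hN]
  push_cast
  rw [Real.log_prod]
  swap
  · intro p hp
    have := ((mem_prs K).1 (hmem p hp).1).1.1
    positivity
  refine le_trans ?_ (Finset.sum_le_sum_of_subset_of_nonneg (s := nf.toFinset)
    (fun p hp => (hmem p hp).1) ?_)
  · apply Finset.sum_le_sum
    intro p hp
    obtain ⟨h1, h2⟩ := hmem p hp
    rw [mem_prs] at h1
    have h3 := two_le_norm K h1.1.1 h1.2
    rw [Real.log_pow, ← Finset.sum_filter, Finset.sum_const, nsmul_eq_mul]
    have hlog : 0 ≤ Real.log (absNorm p) := Real.log_natCast_nonneg _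
    refine mul_le_mul_of_nonneg_right ?_ hlog
    have : nf.count p ≤ N := by
      have h4 := norm_le_of_le K ha'.1 (Ideal.dvd_iff_le.1 h2)
      rw [map_pow] at h4
      have h5 : 2 ^ nf.count p ≤ absNorm p ^ nf.count p := Nat.pow_le_pow_left h3 _
      have h6 := Nat.lt_two_pow_self (n := nf.count p)
      omega
    calc ((nf.count p : ℕ) : ℝ) = ((Finset.Icc 1 (nf.count p)).card : ℝ) := by simp
      _ ≤ _ := by
        norm_cast
        apply Finset.card_le_card
        intro k hk
        rw [Finset.mem_Icc] at hk
        rw [Finset.mem_filter, Finset.mem_Icc]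
        exact ⟨⟨hk.1, by omega⟩, (pow_dvd_pow p hk.2).trans h2⟩
  · intro p _ _
    apply Finset.sum_nonneg
    intro k _
    split_ifs
    · exact Real.log_natCast_nonneg _
    · exact le_rfl

theorem geom_le (x : ℝ) (hx : 2 ≤ x) (N : ℕ) :
    ∑ k ∈ Finset.Icc 1 N, 1 / x ^ k ≤ 2 / x := by
  have hx0 : 0 < x := by linarith
  have key : ∀ N : ℕ, ∑ k ∈ Finset.Icc 1 N, 1 / x ^ k ≤ 2 / x - 1 / x ^ N * (1 / (x - 1)) +
      (1 / (x - 1) - 2 / x) := by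
    intro N
    induction N with
    | zero => simp
    | succ N ih =>
      rw [Finset.sum_Icc_succ_top (by omega)]
      have h1 : 0 < x - 1 := by linarith
      have : 1 / x ^ (N + 1) = 1 / x ^ N * (1 / (x - 1)) - 1 / x ^ (N + 1) * (1 / (x - 1)) := by
        field_simp; ring
      linarith
  have h1 : 0 < x - 1 := by linarith
  have h2 : 1 / (x - 1) ≤ 2 / x := by
    rw [div_le_div_iff₀ h1 hx0]; linarith
  have h3 : 0 ≤ 1 / x ^ N * (1 / (x - 1)) := by positivity
  linarith [key N]

open Classical in
theorem smooth_bound : ∃ C : ℝ, 0 < C ∧ ∀ N Y : ℕ, 1 ≤ N → 1 ≤ Y →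
    (((ids K N).filter (fun a => maxNorm K a ≤ Y)).card : ℝ) * Real.log N ≤
      C * N * (1 + Real.log Y) := by
  obtain ⟨C1, hC1, h1⟩ := ids_bound K
  obtain ⟨C2, hC2, h2⟩ := mertens_bound K
  refine ⟨C1 * 2 + 2 * (C1 * 2 * C2), by positivity, fun N Y hN hY => ?_⟩
  set A := (ids K N).filter (fun a => maxNorm K a ≤ Y) with hA
  have hN' : (1:ℝ) ≤ N := by exact_mod_cast hN
  have hlogN : 0 ≤ Real.log N := Real.log_natCast_nonneg _
  have hlogY : 0 ≤ Real.log Y := Real.log_natCast_nonneg _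
  have hsum : ∑ a ∈ A, Real.log (absNorm a) ≤ C1 * 2 * C2 * N * (1 + Real.log Y) := by
    calc ∑ a ∈ A, Real.log (absNorm a) ≤ ∑ a ∈ A, ∑ p ∈ prs K Y, ∑ k ∈ Finset.Icc 1 N,
          (if p ^ k ∣ a then Real.log (absNorm p) else 0) := by
          apply Finset.sum_le_sum
          intro a ha
          rw [hA, Finset.mem_filter] at ha
          exact log_norm_le K ha.1 ha.2
      _ = ∑ p ∈ prs K Y, ∑ k ∈ Finset.Icc 1 N,
          ((A.filter (fun a => p ^ k ∣ a)).card : ℝ) * Real.log (absNorm p) := by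
          rw [Finset.sum_comm]
          apply Finset.sum_congr rfl
          intro p _
          rw [Finset.sum_comm]
          apply Finset.sum_congr rfl
          intro k _
          rw [← Finset.sum_filter, Finset.sum_const, nsmul_eq_mul]
      _ ≤ ∑ p ∈ prs K Y, ∑ k ∈ Finset.Icc 1 N,
          C1 * N * Real.log (absNorm p) * (1 / (absNorm p : ℝ) ^ k) := by
          apply Finset.sum_le_sum
          intro p hp
          rw [mem_prs] at hp
          apply Finset.sum_le_sum
          intro k _
          have := card_dvd_le K C1 hC1 h1 (p ^ k) (by rw [map_pow]; exact Nat.one_le_pow _ _ hp.1.1) N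
            (A.filter (fun a => p ^ k ∣ a)) (by
              intro a ha
              rw [Finset.mem_filter, hA, Finset.mem_filter] at ha
              exact ⟨ha.1.1, ha.2⟩)
          rw [map_pow] at this
          push_cast at this
          refine (mul_le_mul_of_nonneg_right this (Real.log_natCast_nonneg _)).trans (le_of_eq ?_)
          ring
      _ ≤ ∑ p ∈ prs K Y, C1 * N * Real.log (absNorm p) * (2 / (absNorm p : ℝ)) := by
          apply Finset.sum_le_sum
          intro p hp
          rw [mem_prs] at hp
          rw [← Finset.mul_sum]
          apply mul_le_mul_of_nonneg_left
          · apply geom_le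
            exact_mod_cast two_le_norm K hp.1.1 hp.2
          · have := Real.log_natCast_nonneg (absNorm p)
            positivity
      _ = C1 * 2 * N * ∑ p ∈ prs K Y, Real.log (absNorm p) / (absNorm p : ℝ) := by
          rw [Finset.mul_sum]
          apply Finset.sum_congr rfl
          intro p _
          ring
      _ ≤ C1 * 2 * N * (C2 * (1 + Real.log Y)) := by
          gcongr
          exact h2 Y
      _ = _ := by ring
  -- pointwise
  have hpt : ∀ a ∈ A, Real.log N ≤ (if absNorm a ≤ Nat.sqrt N then Real.log N else 0)
      + 2 * Real.log (absNorm a) := by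
    intro a ha
    rw [hA, Finset.mem_filter, mem_ids] at ha
    split_ifs with h
    · have := Real.log_natCast_nonneg (absNorm a)
      linarith
    · have h3 : N < (absNorm a) ^ 2 := by
        rw [sq]; exact Nat.sqrt_lt.1 (by omega)
      have h4 : Real.log N ≤ Real.log ((absNorm a : ℝ) ^ 2) := by
        apply Real.log_le_log (by linarith)
        exact_mod_cast h3.le
      rw [Real.log_pow] at h4
      push_cast at h4
      linarith
  have hs := Finset.sum_le_sum hpt
  rw [Finset.sum_const, nsmul_eq_mul, Finset.sum_add_distrib, ← Finset.mul_sum,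
    ← Finset.sum_filter, Finset.sum_const, nsmul_eq_mul] at hs
  have hcard : ((A.filter (fun a => absNorm a ≤ Nat.sqrt N)).card : ℝ) ≤ C1 * Real.sqrt N := by
    have : ((A.filter (fun a => absNorm a ≤ Nat.sqrt N)).card : ℝ) ≤ (ids K (Nat.sqrt N)).card := by
      norm_cast
      apply Finset.card_le_card
      intro a ha
      rw [Finset.mem_filter, hA, Finset.mem_filter, mem_ids] at ha
      rw [mem_ids]
      exact ⟨ha.1.1.1, ha.2⟩
    refine this.trans ((h1 _).trans ?_)
    gcongr
    exact Real.nat_sqrt_le_real_sqrt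
  have hsp : 0 < Real.sqrt N := Real.sqrt_pos.2 (by linarith)
  have hsq : Real.sqrt N * Real.sqrt N = N := Real.mul_self_sqrt (by linarith)
  have h3 : Real.log N ≤ 2 * Real.sqrt N := by
    have := Real.log_le_sub_one_of_pos hsp
    rw [Real.log_sqrt (by linarith)] at this
    linarith
  have h4 : ((A.filter (fun a => absNorm a ≤ Nat.sqrt N)).card : ℝ) * Real.log N ≤
      C1 * 2 * N := by
    calc _ ≤ C1 * Real.sqrt N * (2 * Real.sqrt N) := by gcongr
      _ = C1 * 2 * (Real.sqrt N * Real.sqrt N) := by ring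
      _ = _ := by rw [hsq]
  have h5 : C1 * 2 * (N:ℝ) ≤ C1 * 2 * N * (1 + Real.log Y) := by
    apply le_mul_of_one_le_right (by positivity); linarith
  calc _ ≤ _ := hs
    _ ≤ C1 * 2 * N * (1 + Real.log Y) + 2 * (C1 * 2 * C2 * N * (1 + Real.log Y)) := by linarith
    _ = _ := by ring

/-! ### Part 3: ideals with two maximal primes -/

open Classical in
theorem multi_bound : ∃ C : ℝ, 0 < C ∧ ∀ N Y : ℕ, 1 ≤ Y →
    ∑ a ∈ (ids K N).filter (fun a => Y < maxNorm K a), ((QS K Set.univ a : ℝ) - 1) ≤ C * N / Y := by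
  obtain ⟨C1, hC1, h1⟩ := ids_bound K
  set d := Module.finrank ℤ (𝓞 K) with hd
  refine ⟨C1 * d * d + 1, by positivity, fun N Y hY => ?_⟩
  set A := (ids K N).filter (fun a => Y < maxNorm K a) with hA
  set P := (prs K N).filter (fun p => Y < absNorm p) with hP
  have hpt : ∀ a ∈ A, (QS K Set.univ a : ℝ) - 1 ≤
      ∑ p ∈ P, ∑ q ∈ P with q ≠ p ∧ absNorm q = absNorm p, if p * q ∣ a then (1:ℝ) else 0 := by
    intro a ha
    rw [hA, Finset.mem_filter] at ha
    have ha1 := (mem_ids K).1 ha.1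
    obtain ⟨p, hp, hap, hpm⟩ := exists_maxNorm K ha1.1 (by omega)
    have hpn := norm_le_of_le K ha1.1 hap
    have hpP : p ∈ P := by
      rw [hP, Finset.mem_filter, mem_prs]
      exact ⟨⟨⟨hpn.1, by omega⟩, hp⟩, by omega⟩
    refine le_trans ?_ (Finset.single_le_sum (f := fun p =>
      ∑ q ∈ P with q ≠ p ∧ absNorm q = absNorm p, if p * q ∣ a then (1:ℝ) else 0) ?_ hpP)
    · have hQ := QS_eq K Set.univ ha.1
      rw [hQ, ← Finset.sum_filter, Finset.sum_const, nsmul_eq_mul, mul_one,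
        sub_le_iff_le_add]
      norm_cast
      rw [← Finset.card_insert_of_notMem (a := p) (by simp)]
      apply Finset.card_le_card
      intro q hq
      simp only [Finset.mem_filter, mem_prs] at hq
      rw [Finset.mem_insert]
      by_cases hqp : q = p
      · exact Or.inl hqp
      right
      simp only [Finset.mem_filter, hP, mem_prs]
      refine ⟨⟨⟨hq.1, by omega⟩, hqp, by omega⟩, ?_⟩
      have hp' := prime_of_isPrime (ne_bot_of_norm K hpn.1) hp
      have hq' := prime_of_isPrime (ne_bot_of_norm K hq.1.1.1) hq.1.2
      have := Finset.prod_primes_dvd (s := {p, q}) a (by simp [hp', hq']) (by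
        simp only [Finset.mem_insert, Finset.mem_singleton, forall_eq_or_imp, forall_eq]
        exact ⟨Ideal.dvd_iff_le.2 hap, Ideal.dvd_iff_le.2 hq.2.1⟩)
      rwa [Finset.prod_pair (Ne.symm hqp)] at this
    · intro p _
      positivity
  calc _ ≤ ∑ a ∈ A, ∑ p ∈ P, ∑ q ∈ P with q ≠ p ∧ absNorm q = absNorm p,
        (if p * q ∣ a then (1:ℝ) else 0) := Finset.sum_le_sum hpt
    _ = ∑ p ∈ P, ∑ q ∈ P with q ≠ p ∧ absNorm q = absNorm p,
        ((A.filter (fun a => p * q ∣ a)).card : ℝ) := by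
        rw [Finset.sum_comm]
        apply Finset.sum_congr rfl
        intro p _
        rw [Finset.sum_comm]
        apply Finset.sum_congr rfl
        intro q _
        rw [← Finset.sum_filter, Finset.sum_const, nsmul_eq_mul, mul_one]
    _ ≤ ∑ p ∈ P, ∑ q ∈ P with q ≠ p ∧ absNorm q = absNorm p,
        C1 * N * (((absNorm p : ℝ) ^ 2)⁻¹) := by
        apply Finset.sum_le_sum
        intro p hp
        apply Finset.sum_le_sum
        intro q hq
        simp only [hP, Finset.mem_filter, mem_prs] at hp hq
        have := card_dvd_le K C1 hC1 h1 (p * q)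
          (by rw [map_mul]; exact Nat.mul_pos hp.1.1.1 hq.1.1.1.1) N
          (A.filter (fun a => p * q ∣ a)) (by
            intro a ha
            rw [Finset.mem_filter, hA, Finset.mem_filter] at ha
            exact ⟨ha.1.1, ha.2⟩)
        rw [map_mul, hq.2.2] at this
        push_cast at this
        refine this.trans (le_of_eq ?_)
        ring
    _ ≤ ∑ p ∈ P, d * (C1 * N * (((absNorm p : ℝ) ^ 2)⁻¹)) := by
        apply Finset.sum_le_sum
        intro p hp
        rw [Finset.sum_const, nsmul_eq_mul]
        apply mul_le_mul_of_nonneg_right _ (by positivity)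
        norm_cast
        apply card_same_norm K _ (absNorm p)
        intro q hq
        simp only [hP, Finset.mem_filter, mem_prs] at hq
        exact ⟨hq.1.1.1.1, hq.1.1.2, hq.2.2⟩
    _ = ∑ n ∈ Finset.Ioc Y N, ∑ p ∈ P with absNorm p = n,
          d * (C1 * N * (((absNorm p : ℝ) ^ 2)⁻¹)) := by
        rw [Finset.sum_fiberwise_of_maps_to]
        intro p hp
        simp only [hP, Finset.mem_filter, mem_prs] at hp
        rw [Finset.mem_Ioc]; omega
    _ ≤ ∑ n ∈ Finset.Ioc Y N, d * (d * (C1 * N * (((n : ℝ) ^ 2)⁻¹))) := by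
        apply Finset.sum_le_sum
        intro n _
        have : ∑ p ∈ P with absNorm p = n, d * (C1 * N * (((absNorm p : ℝ) ^ 2)⁻¹))
          = ∑ p ∈ P with absNorm p = n, d * (C1 * N * (((n : ℝ) ^ 2)⁻¹)) := by
          apply Finset.sum_congr rfl
          intro p hp
          rw [(Finset.mem_filter.1 hp).2]
        rw [this, Finset.sum_const, nsmul_eq_mul]
        apply mul_le_mul_of_nonneg_right _ (by positivity)
        norm_cast
        apply card_same_norm K _ n
        intro q hq
        simp only [hP, Finset.mem_filter, mem_prs] at hq
        exact ⟨hq.1.1.1.1, hq.1.1.2, hq.2⟩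
    _ = C1 * d * d * N * ∑ n ∈ Finset.Ioc Y N, ((n : ℝ) ^ 2)⁻¹ := by
        rw [Finset.mul_sum]
        apply Finset.sum_congr rfl
        intro n _
        ring
    _ ≤ C1 * d * d * N * (Y : ℝ)⁻¹ := by
        apply mul_le_mul_of_nonneg_left _ (by positivity)
        rcases le_or_gt Y N with h | h
        · have := sum_Ioc_inv_sq_le_sub (α := ℝ) (k := Y) (n := N) (by omega) h
          have h' : 0 ≤ (N:ℝ)⁻¹ := by positivity
          linarith
        · rw [Finset.Ioc_eq_empty (by omega)]
          simp
    _ ≤ (C1 * d * d + 1) * N * (Y:ℝ)⁻¹ := by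
        gcongr
        linarith
    _ = _ := by ring

/-! ### Part 4: decomposition of the sum and comparison with the density -/

theorem primes_finite (S : Set (Ideal (𝓞 K))) (n : ℕ) :
    {p : Ideal (𝓞 K) | p.IsPrime ∧ p ∈ S ∧ (absNorm p : ℝ) ≤ n}.Finite := by
  apply (Ideal.finite_setOfPred_absNorm_le (S := 𝓞 K) n).subset
  rintro p ⟨_, _, h⟩
  exact_mod_cast h

/-- Prime ideals (including zero) of norm at most `n` in `S`, as a finset. -/
def prs0 (S : Set (Ideal (𝓞 K))) (n : ℕ) : Finset (Ideal (𝓞 K)) := (primes_finite K S n).toFinset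

theorem mem_prs0 {S : Set (Ideal (𝓞 K))} {n : ℕ} {p : Ideal (𝓞 K)} :
    p ∈ prs0 K S n ↔ p.IsPrime ∧ p ∈ S ∧ absNorm p ≤ n := by
  simp [prs0]

theorem primeCount_eq (S : Set (Ideal (𝓞 K))) (n : ℕ) :
    primeCount K S n = (prs0 K S n).card := by
  rw [primeCount, ← Fintype.card_coe, ← Nat.card_eq_fintype_card]
  apply Nat.card_congr
  apply Equiv.subtypeEquivRight
  intro p
  rw [mem_prs0]
  simp

open Classical in
theorem primeCount_add (S : Set (Ideal (𝓞 K))) {m n : ℕ} (h : m ≤ n) :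
    primeCount K S n = primeCount K S m +
      ((prs K n).filter (fun p => p ∈ S ∧ m < absNorm p)).card := by
  rw [primeCount_eq, primeCount_eq, ← Finset.card_union_of_disjoint]
  · congr 1
    ext p
    simp only [Finset.mem_union, Finset.mem_filter, mem_prs0, mem_prs]
    constructor
    · rintro ⟨h1, h2, h3⟩
      by_cases h4 : absNorm p ≤ m
      · exact Or.inl ⟨h1, h2, h4⟩
      · exact Or.inr ⟨⟨⟨by omega, h3⟩, h1⟩, h2, by omega⟩
    · rintro (⟨h1, h2, h3⟩ | ⟨⟨⟨_, h3⟩, h1⟩, h2, h4⟩)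
      · exact ⟨h1, h2, by omega⟩
      · exact ⟨h1, h2, h3⟩
  · rw [Finset.disjoint_left]
    intro p hp hp'
    simp only [Finset.mem_filter, mem_prs0, mem_prs] at hp hp'
    omega

theorem primeCount_univ_le (n : ℕ) : primeCount K Set.univ n ≤ (prs K n).card + 1 := by
  classical
  rw [primeCount_eq]
  refine le_trans (Finset.card_le_card (t := insert ⊥ (prs K n)) ?_) (Finset.card_insert_le _ _)
  intro p hp
  rw [mem_prs0] at hp
  rw [Finset.mem_insert, mem_prs]
  by_cases h : p = ⊥
  · exact Or.inl h
  · exact Or.inr ⟨⟨norm_pos_of_ne K h, hp.2.2⟩, hp.1⟩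

theorem primeCount_univ_pos (n : ℕ) : 0 < primeCount K Set.univ n := by
  rw [primeCount_eq, Finset.card_pos]
  refine ⟨⊥, ?_⟩
  rw [mem_prs0]
  exact ⟨Ideal.isPrime_bot, trivial, by simp⟩

theorem primeCount_univ_mono {m n : ℕ} (h : m ≤ n) :
    primeCount K Set.univ m ≤ primeCount K Set.univ n := by
  classical
  rw [primeCount_add K Set.univ h]
  omega

theorem density_nat {S : Set (Ideal (𝓞 K))} {δ : ℝ} (hδ : HasPrimeDensity K S δ)
    {η : ℝ} (hη : 0 < η) : ∃ n0 : ℕ, ∀ n : ℕ, n0 ≤ n →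
      |(primeCount K S n : ℝ) - δ * primeCount K Set.univ n| ≤ η * primeCount K Set.univ n := by
  have h := Tendsto.comp hδ tendsto_natCast_atTop_atTop (α := ℕ)
  rw [Metric.tendsto_atTop] at h
  obtain ⟨n0, h0⟩ := h η hη
  refine ⟨n0, fun n hn => ?_⟩
  have h1 := h0 n hn
  simp only [Function.comp_apply, Real.dist_eq] at h1
  have hpos : (0:ℝ) < primeCount K Set.univ (n:ℝ) := by exact_mod_cast primeCount_univ_pos K n
  have : (primeCount K S n : ℝ) - δ * primeCount K Set.univ n =
      ((primeCount K S n : ℝ) / primeCount K Set.univ n - δ) * primeCount K Set.univ n := by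
    field_simp
  rw [this, abs_mul, abs_of_pos hpos]
  exact mul_le_mul_of_nonneg_right h1.le hpos.le

open Classical in
/-- Sum of `Q_S` over ideals of norm at most `N` with maximal norm exceeding `Y`. -/
def WS (S : Set (Ideal (𝓞 K))) (N Y : ℕ) : ℕ :=
  ∑ a ∈ (ids K N).filter (fun a => Y < maxNorm K a), QS K S a

open Classical in
theorem WS_eq (S : Set (Ideal (𝓞 K))) (N Y : ℕ) :
    WS K S N Y = ∑ b ∈ ids K N, ((prs K (N / absNorm b)).filter
      (fun p => p ∈ S ∧ max (maxNorm K b - 1) Y < absNorm p)).card := by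
  have h1 : WS K S N Y = ∑ a ∈ (ids K N).filter (fun a => Y < maxNorm K a),
      ((prs K N).filter (fun p => a ≤ p ∧ p ∈ S ∧ absNorm p = maxNorm K a)).card := by
    rw [WS]
    apply Finset.sum_congr rfl
    intro a ha
    exact QS_eq K S (Finset.mem_filter.1 ha).1
  rw [h1, ← Finset.card_sigma, ← Finset.card_sigma]
  symm
  apply Finset.card_bij (fun x _ => (⟨x.2 * x.1, x.2⟩ : Σ _ : Ideal (𝓞 K), Ideal (𝓞 K)))
  · rintro ⟨b, p⟩ hx
    simp only [Finset.mem_sigma, Finset.mem_filter, mem_ids, mem_prs] at hx ⊢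
    obtain ⟨⟨hb1, hb2⟩, ⟨⟨hp1, hp2⟩, hp⟩, hpS, hlt⟩ := hx
    rw [maxNorm_mul K hp hp1 hb1, map_mul]
    rw [Nat.le_div_iff_mul_le hb1] at hp2
    rw [max_lt_iff] at hlt
    have hle : absNorm p ≤ absNorm p * absNorm b := Nat.le_mul_of_pos_right _ hb1
    refine ⟨⟨⟨Nat.mul_pos hp1 hb1, hp2⟩, ?_⟩, ⟨⟨hp1, by omega⟩, hp⟩, Ideal.mul_le_left, hpS, ?_⟩
    · omega
    · rw [max_eq_left (by omega)]
  · rintro ⟨b, p⟩ hx ⟨b', p'⟩ hx' h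
    simp only [Finset.mem_sigma, Finset.mem_filter, mem_ids, mem_prs] at hx hx'
    simp only [Sigma.mk.injEq, heq_eq_eq] at h
    obtain ⟨h1, rfl⟩ := h
    have := mul_left_cancel₀ (ne_bot_of_norm K hx.2.1.1.1) h1
    rw [this]
  · rintro ⟨a, p⟩ hx
    simp only [Finset.mem_sigma, Finset.mem_filter, mem_ids, mem_prs] at hx
    obtain ⟨⟨⟨ha1, ha2⟩, hY⟩, ⟨⟨hp1, hp2⟩, hp⟩, hap, hpS, hm⟩ := hx
    obtain ⟨b, rfl⟩ := Ideal.dvd_iff_le.2 hap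
    rw [map_mul] at ha1 ha2
    have hb1 : 1 ≤ absNorm b := Nat.pos_of_mul_pos_left ha1
    rw [maxNorm_mul K hp hp1 hb1] at hY hm
    have hb2 : absNorm b ≤ absNorm p * absNorm b := Nat.le_mul_of_pos_left _ hp1
    refine ⟨⟨b, p⟩, ?_, rfl⟩
    simp only [Finset.mem_sigma, Finset.mem_filter, mem_ids, mem_prs, max_lt_iff]
    rw [Nat.le_div_iff_mul_le hb1]
    refine ⟨⟨hb1, by omega⟩, ⟨⟨hp1, ha2⟩, hp⟩, hpS, ?_, ?_⟩ <;> omega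

theorem diff_bound : ∃ C : ℝ, 0 < C ∧ ∀ (S : Set (Ideal (𝓞 K))) (δ η : ℝ) (N Y : ℕ), 0 ≤ η →
    1 ≤ Y →
    (∀ n : ℕ, Y ≤ n → |(primeCount K S n : ℝ) - δ * primeCount K Set.univ n| ≤
      η * primeCount K Set.univ n) →
    |(WS K S N Y : ℝ) - δ * WS K Set.univ N Y| ≤
      C * η * N * (1 + Real.log N) / Real.log (Y + 1 : ℕ) := by
  classical
  obtain ⟨C2, hC2, h2⟩ := sum_inv_bound K
  obtain ⟨C3, hC3, h3⟩ := pi_bound K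
  refine ⟨2 * C3 * C2, by positivity, fun S δ η N Y hη hY h => ?_⟩
  have hY1 : (1:ℝ) < ((Y + 1 : ℕ) : ℝ) := by exact_mod_cast (by omega : 1 < Y + 1)
  have hlogY : 0 < Real.log (Y + 1 : ℕ) := Real.log_pos hY1
  have hW : (WS K S N Y : ℝ) - δ * WS K Set.univ N Y = ∑ b ∈ ids K N,
     ((((prs K (N / absNorm b)).filter
        (fun p => p ∈ S ∧ max (maxNorm K b - 1) Y < absNorm p)).card : ℝ) -
      δ * (((prs K (N / absNorm b)).filter
        (fun p => p ∈ (Set.univ : Set (Ideal (𝓞 K))) ∧ max (maxNorm K b - 1) Y < absNorm p)).card : ℝ)) := by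
    rw [Finset.sum_sub_distrib, ← Finset.mul_sum, WS_eq, WS_eq]
    push_cast
    congr!
  rw [hW]
  refine (Finset.abs_sum_le_sum_abs _ _).trans ?_
  calc _ ≤ ∑ b ∈ ids K N, 2 * η * C3 * N / Real.log (Y + 1 : ℕ) * (1 / (absNorm b : ℝ)) := by
        apply Finset.sum_le_sum
        intro b hb
        rw [mem_ids] at hb
        set m := max (maxNorm K b - 1) Y with hm
        set n := N / absNorm b with hn
        have hnonneg : 0 ≤ 2 * η * C3 * N / Real.log (Y + 1 : ℕ) * (1 / (absNorm b : ℝ)) := by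
          positivity
        rcases le_or_gt n m with hnm | hnm
        · have hz : ∀ S : Set (Ideal (𝓞 K)),
              ((prs K n).filter (fun p => p ∈ S ∧ m < absNorm p)).card = 0 := by
            intro S
            rw [Finset.card_eq_zero, Finset.filter_eq_empty_iff]
            intro p hp
            rw [mem_prs] at hp
            omega
          have hz1 := hz S
          have hz2 := hz Set.univ
          simp only [Set.mem_univ, true_and] at hz2 ⊢
          rw [hz1, hz2]
          simpa using hnonneg
        · have hYm : Y ≤ m := le_max_right _ _
          have e1 := primeCount_add K S hnm.le
          have e2 := primeCount_add K Set.univ hnm.le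
          have b1 := h n (by omega)
          have b2 := h m hYm
          have b3 : (primeCount K Set.univ (m:ℝ) : ℝ) ≤ primeCount K Set.univ (n:ℝ) := by
            exact_mod_cast primeCount_univ_mono K hnm.le
          have b4 : (primeCount K Set.univ (n:ℝ) : ℝ) ≤ C3 * n / Real.log n := by
            refine le_trans ?_ (h3 n (by omega))
            exact_mod_cast primeCount_univ_le K n
          have b5 : C3 * n / Real.log n ≤ C3 * (N / (absNorm b : ℝ)) / Real.log (Y + 1 : ℕ) := by
            have : (n:ℝ) ≤ N / (absNorm b : ℝ) := Nat.cast_div_le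
            have hlog : Real.log (Y + 1 : ℕ) ≤ Real.log n := by
              apply Real.log_le_log (by linarith)
              exact_mod_cast (by omega : Y + 1 ≤ n)
            gcongr
          simp only [Set.mem_univ, true_and] at e2 ⊢
          rw [e1, e2] at b1
          push_cast at b1
          have b6 : (((primeCount K Set.univ (m:ℝ) +
            ((prs K n).filter (fun p => m < absNorm p)).card : ℕ) : ℝ)) ≤
              C3 * (N / (absNorm b : ℝ)) / Real.log (Y + 1 : ℕ) := by
            rw [← e2]; exact b4.trans b5
          push_cast at b6
          have b7 : 2 * η * (C3 * (N / (absNorm b : ℝ)) / Real.log (Y + 1 : ℕ)) =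
            2 * η * C3 * N / Real.log (Y + 1 : ℕ) * (1 / (absNorm b : ℝ)) := by ring
          rw [← b7]
          rw [e2] at b3
          push_cast at b3
          have c1 := mul_le_mul_of_nonneg_left b6 hη
          have c2 := mul_le_mul_of_nonneg_left b3 hη
          push_cast at c1 c2 ⊢
          rw [abs_le] at b1 b2 ⊢
          constructor <;> linarith [b1.1, b1.2, b2.1, b2.2]
    _ = 2 * η * C3 * N / Real.log (Y + 1 : ℕ) * ∑ b ∈ ids K N, (1 / (absNorm b : ℝ)) := by
        rw [Finset.mul_sum]
    _ ≤ 2 * η * C3 * N / Real.log (Y + 1 : ℕ) * (C2 * (1 + Real.log N)) := by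
        gcongr
        exact h2 N
    _ = _ := by ring

/-- Sum of `Q_S` over nonzero ideals of norm at most `N`. -/
def FS (S : Set (Ideal (𝓞 K))) (N : ℕ) : ℕ := ∑ a ∈ ids K N, QS K S a

open Classical in
theorem FS_bound (S : Set (Ideal (𝓞 K))) (δ : ℝ) (N Y : ℕ) (hY : 1 ≤ Y) (E D s : ℝ)
    (hs : (((ids K N).filter (fun a => maxNorm K a ≤ Y)).card : ℝ) ≤ s)
    (hE : ∑ a ∈ (ids K N).filter (fun a => Y < maxNorm K a), ((QS K Set.univ a : ℝ) - 1) ≤ E)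
    (hD : |(WS K S N Y : ℝ) - δ * WS K Set.univ N Y| ≤ D) :
    |(FS K S N : ℝ) - δ * (ids K N).card| ≤
      (Module.finrank ℤ (𝓞 K) + |δ|) * s + D + |δ| * E := by
  set Sm := (ids K N).filter (fun a => maxNorm K a ≤ Y) with hSm
  set A := (ids K N).filter (fun a => Y < maxNorm K a) with hA
  set d := Module.finrank ℤ (𝓞 K)
  have hnot : (ids K N).filter (fun a => ¬ maxNorm K a ≤ Y) = A := by
    rw [hA]; congr 1; ext a; rw [not_le]
  have h1 : FS K S N = ∑ a ∈ Sm, QS K S a + WS K S N Y := by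
    rw [FS, WS, ← Finset.sum_filter_add_sum_filter_not (ids K N) (fun a => maxNorm K a ≤ Y), hnot]
  have h2 : (ids K N).card = Sm.card + A.card := by
    rw [← Finset.card_filter_add_card_filter_not (s := ids K N) (fun a => maxNorm K a ≤ Y), hnot]
  have h3 : ∑ a ∈ Sm, QS K S a ≤ Sm.card * d := by
    rw [← smul_eq_mul]
    apply Finset.sum_le_card_nsmul
    intro a ha
    exact QS_le K S (Finset.mem_filter.1 ha).1
  have h4 : ∑ a ∈ A, ((QS K Set.univ a : ℝ) - 1) = (WS K Set.univ N Y : ℝ) - A.card := by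
    rw [Finset.sum_sub_distrib, WS]; simp [hA]
  have h5 : 0 ≤ ∑ a ∈ A, ((QS K Set.univ a : ℝ) - 1) := by
    apply Finset.sum_nonneg
    intro a ha
    rw [hA, Finset.mem_filter] at ha
    have ha1 := (mem_ids K).1 ha.1
    obtain ⟨p, hp, hap, hpm⟩ := exists_maxNorm K ha1.1 (by omega)
    have hpn := norm_le_of_le K ha1.1 hap
    have : 1 ≤ QS K Set.univ a := by
      have hQ := QS_eq K Set.univ ha.1
      rw [hQ, Nat.one_le_iff_ne_zero, Finset.card_ne_zero]
      refine ⟨p, ?_⟩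
      simp only [Finset.mem_filter, mem_prs]
      exact ⟨⟨⟨hpn.1, by omega⟩, hp⟩, hap, trivial, hpm⟩
    have : (1:ℝ) ≤ QS K Set.univ a := by exact_mod_cast this
    linarith
  rw [h4] at h5 hE
  have h3' : ((∑ a ∈ Sm, QS K S a : ℕ) : ℝ) ≤ d * s := by
    calc ((∑ a ∈ Sm, QS K S a : ℕ) : ℝ) ≤ Sm.card * d := by exact_mod_cast h3
      _ ≤ s * d := by gcongr
      _ = _ := mul_comm _ _
  have h3'' : (0:ℝ) ≤ ((∑ a ∈ Sm, QS K S a : ℕ) : ℝ) := by positivity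
  have e : (FS K S N : ℝ) - δ * (ids K N).card = ((∑ a ∈ Sm, QS K S a : ℕ) : ℝ) +
      ((WS K S N Y : ℝ) - δ * WS K Set.univ N Y) + δ * ((WS K Set.univ N Y : ℝ) - A.card)
      - δ * Sm.card := by
    rw [h1, h2]; push_cast; ring
  rw [e]
  have t1 : |δ * ((WS K Set.univ N Y : ℝ) - A.card)| ≤ |δ| * E := by
    rw [abs_mul, abs_of_nonneg h5]; gcongr
  have t2 : |δ * (Sm.card : ℝ)| ≤ |δ| * s := by
    rw [abs_mul, abs_of_nonneg (by positivity : (0:ℝ) ≤ Sm.card)]; gcongr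
  rw [abs_le] at hD t1 t2 ⊢
  constructor <;> linarith [hD.1, hD.2, t1.1, t1.2, t2.1, t2.2]

theorem FS_diff_tendsto (S : Set (Ideal (𝓞 K))) (δ : ℝ) (hδ : HasPrimeDensity K S δ) :
    Tendsto (fun N : ℕ => ((FS K S N : ℝ) - δ * (ids K N).card) / N) atTop (nhds 0) := by
  classical
  obtain ⟨C1, hC1, h1⟩ := smooth_bound K
  obtain ⟨C2, hC2, h2⟩ := multi_bound K
  obtain ⟨C3, hC3, h3⟩ := diff_bound K
  set d : ℝ := (Module.finrank ℤ (𝓞 K) : ℝ) with hd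
  set B : ℝ := d + |δ| + 1 with hB
  have hd0 : 0 ≤ d := by positivity
  have hδ0 := abs_nonneg δ
  have hB0 : 0 < B := by positivity
  rw [Metric.tendsto_atTop']
  intro t ht
  -- choose parameters
  set ε : ℝ := t / (5 * B * C1) with hε
  have hε0 : 0 < ε := by positivity
  set η : ℝ := t * ε / (10 * C3) with hη
  have hη0 : 0 < η := by positivity
  obtain ⟨n0, hn0⟩ := density_nat K hδ hη0
  have hpow : Tendsto (fun N : ℕ => (N:ℝ) ^ ε) atTop atTop :=
    (tendsto_rpow_atTop hε0).comp tendsto_natCast_atTop_atTop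
  have hfl : Tendsto (fun N : ℕ => ⌊(N:ℝ) ^ ε⌋₊) atTop atTop := tendsto_nat_floor_atTop.comp hpow
  have hlog : Tendsto (fun N : ℕ => Real.log N) atTop atTop :=
    Real.tendsto_log_atTop.comp tendsto_natCast_atTop_atTop
  have ev : ∀ᶠ N : ℕ in atTop, 2 ≤ N ∧ max n0 1 ≤ ⌊(N:ℝ) ^ ε⌋₊ ∧
      5 * B * C2 / t ≤ ((⌊(N:ℝ) ^ ε⌋₊ : ℕ) : ℝ) ∧ max 1 (5 * B * C1 / t) ≤ Real.log N :=
    (eventually_ge_atTop 2).and ((hfl.eventually_ge_atTop _).and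
      (((tendsto_natCast_atTop_atTop.comp hfl).eventually_ge_atTop _).and
        (hlog.eventually_ge_atTop _)))
  obtain ⟨N0, hN0⟩ := eventually_atTop.1 ev
  refine ⟨N0, fun N hN => ?_⟩
  obtain ⟨hN2, hY, hY2, hL⟩ := hN0 N hN.le
  set Y := ⌊(N:ℝ) ^ ε⌋₊ with hYdef
  have hY1 : 1 ≤ Y := (le_max_right _ _).trans hY
  have hYn : n0 ≤ Y := (le_max_left _ _).trans hY
  have hNpos : (0:ℝ) < N := by exact_mod_cast (by omega : 0 < N)
  have hYpos : (0:ℝ) < Y := by exact_mod_cast hY1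
  have hL1 : 1 ≤ Real.log N := (le_max_left _ _).trans hL
  have hL2 : 5 * B * C1 / t ≤ Real.log N := (le_max_right _ _).trans hL
  have hL0 : 0 < Real.log N := by linarith
  have hlogY : Real.log Y ≤ ε * Real.log N := by
    rw [← Real.log_rpow hNpos]
    exact Real.log_le_log hYpos (Nat.floor_le (by positivity))
  have hlogY1 : ε * Real.log N ≤ Real.log (Y + 1 : ℕ) := by
    rw [← Real.log_rpow hNpos]
    apply Real.log_le_log (by positivity)
    push_cast
    exact (Nat.lt_floor_add_one _).le
  have hs : (((ids K N).filter (fun a => maxNorm K a ≤ Y)).card : ℝ) ≤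
      N * (2 * t / (5 * B)) := by
    have h := h1 N Y (by omega) hY1
    rw [← le_div_iff₀ hL0] at h
    refine h.trans ?_
    rw [div_le_iff₀ hL0]
    have q1 : C1 * ε = t / (5 * B) := by rw [hε]; field_simp
    have q2 : C1 ≤ t / (5 * B) * Real.log N := by
      rw [div_le_iff₀ ht] at hL2
      rw [div_mul_eq_mul_div, le_div_iff₀ (by positivity)]
      linarith
    calc C1 * N * (1 + Real.log Y) ≤ C1 * N * (1 + ε * Real.log N) := by gcongr
      _ = N * (C1 + C1 * ε * Real.log N) := by ring
      _ ≤ N * (t / (5 * B) * Real.log N + t / (5 * B) * Real.log N) := by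
        rw [q1]; gcongr
      _ = _ := by ring
  have hE := h2 N Y hY1
  have hE' : C2 * N / Y ≤ N * (t / (5 * B)) := by
    rw [div_le_iff₀ ht] at hY2
    rw [div_le_iff₀ hYpos]
    have : C2 ≤ t / (5 * B) * Y := by
      rw [div_mul_eq_mul_div, le_div_iff₀ (by positivity)]
      linarith
    calc C2 * N ≤ (t / (5 * B) * Y) * N := by gcongr
      _ = _ := by ring
  have hD := h3 S δ η N Y hη0.le hY1 (fun n hn => hn0 n (hYn.trans hn))
  have hD' : C3 * η * N * (1 + Real.log N) / Real.log (Y + 1 : ℕ) ≤ N * (t / 5) := by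
    have hLY : 0 < Real.log (Y + 1 : ℕ) := lt_of_lt_of_le (by positivity) hlogY1
    rw [div_le_iff₀ hLY]
    have q : C3 * η = t / 10 * ε := by rw [hη]; field_simp
    calc C3 * η * N * (1 + Real.log N) ≤ C3 * η * N * (2 * Real.log N) := by gcongr; linarith
      _ = N * (t / 5) * (ε * Real.log N) := by rw [q]; ring
      _ ≤ _ := by gcongr
  have hfin := FS_bound K S δ N Y hY1 _ _ _ hs (hE.trans hE') (hD.trans hD')
  rw [← hd] at hfin
  rw [Real.dist_eq, sub_zero, abs_div, abs_of_pos hNpos, div_lt_iff₀ hNpos]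
  refine lt_of_le_of_lt hfin ?_
  have r1 : (d + |δ|) * (N * (2 * t / (5 * B))) ≤ N * (2 * t / 5) := by
    have : (d + |δ|) * (2 * t / (5 * B)) ≤ 2 * t / 5 := by
      calc (d + |δ|) * (2 * t / (5 * B)) ≤ B * (2 * t / (5 * B)) := by gcongr; linarith
        _ = _ := by field_simp
    calc _ = N * ((d + |δ|) * (2 * t / (5 * B))) := by ring
      _ ≤ _ := by gcongr
  have r2 : |δ| * (N * (t / (5 * B))) ≤ N * (t / 5) := by
    have : |δ| * (t / (5 * B)) ≤ t / 5 := by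
      calc |δ| * (t / (5 * B)) ≤ B * (t / (5 * B)) := by gcongr; linarith
        _ = _ := by field_simp
    calc _ = N * (|δ| * (t / (5 * B))) := by ring
      _ ≤ _ := by gcongr
  have : 0 < N * t := by positivity
  linarith

theorem FS_tendsto (S : Set (Ideal (𝓞 K))) (δ : ℝ) (hδ : HasPrimeDensity K S δ) :
    Tendsto (fun N : ℕ => (FS K S N : ℝ) / N) atTop (nhds (cK K * δ)) := by
  have h := (FS_diff_tendsto K S δ hδ).add ((ids_tendsto K).mul_const δ)
  rw [zero_add] at h
  refine h.congr fun N => ?_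
  ring

theorem tsum_eq_FS (S : Set (Ideal (𝓞 K))) {X : ℝ} (hX : 0 ≤ X) :
    (∑' a : {a : Ideal (𝓞 K) // 2 ≤ absNorm a ∧ (absNorm a : ℝ) ≤ X}, (QS K S a.1 : ℝ)) =
      (FS K S ⌊X⌋₊ : ℝ) := by
  classical
  have hiff : ∀ a : Ideal (𝓞 K), (2 ≤ absNorm a ∧ (absNorm a : ℝ) ≤ X) ↔
      a ∈ (ids K ⌊X⌋₊).filter (fun a => 2 ≤ absNorm a) := by
    intro a
    rw [Finset.mem_filter, mem_ids, Nat.le_floor_iff hX]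
    constructor
    · rintro ⟨h1, h2⟩; exact ⟨⟨by omega, h2⟩, h1⟩
    · rintro ⟨⟨_, h2⟩, h1⟩; exact ⟨h1, h2⟩
  rw [← Equiv.tsum_eq (Equiv.subtypeEquivRight hiff).symm]
  change (∑' a : {a // a ∈ (ids K ⌊X⌋₊).filter (fun a => 2 ≤ absNorm a)}, (QS K S a.1 : ℝ)) = _
  rw [Finset.tsum_subtype _ (fun a => (QS K S a : ℝ)), FS, Nat.cast_sum]
  apply Finset.sum_subset (Finset.filter_subset _ _)
  intro a ha ha'
  rw [Finset.mem_filter, not_and] at ha'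
  have h1 := ha' ha
  rw [QS_eq K S ha, Nat.cast_eq_zero, Finset.card_eq_zero, Finset.filter_eq_empty_iff]
  rw [mem_ids] at ha
  intro p hp hp'
  rw [mem_prs] at hp
  have h2 := two_le_norm K hp.1.1 hp.2
  have h3 := norm_le_of_le K ha.1 hp'.1
  omega

/-- `∑_{2 ≤ N(a) ≤ X} Q_S(a) ∼ c_K δ(S) X`. -/
theorem qs_sum_asymptotic (S : Set (Ideal (𝓞 K))) (hS : ∀ p ∈ S, p.IsPrime)
    (δ : ℝ) (hδ : HasPrimeDensity K S δ) :
    Tendsto (fun X : ℝ =>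
        (∑' a : {a : Ideal (𝓞 K) // 2 ≤ absNorm a ∧ (absNorm a : ℝ) ≤ X},
          (QS K S a.1 : ℝ)) / X)
      atTop (nhds (cK K * δ)) := by
  have h := ((FS_tendsto K S δ hδ).comp (tendsto_nat_floor_atTop (α := ℝ))).mul
    (tendsto_nat_floor_div_atTop (R := ℝ))
  rw [mul_one] at h
  refine h.congr' ?_
  filter_upwards [eventually_ge_atTop 1] with X hX
  rw [tsum_eq_FS K S (by linarith)]
  have h1 : (0:ℝ) < (⌊X⌋₊ : ℝ) := by
    exact_mod_cast Nat.floor_pos.2 hX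
  simp only [Function.comp_apply]
  field_simp

end AlladiGen
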